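/- Let (θ,p) ~ N(0, I₂) on ℝ² and ΔH = (1/2)(Aθ² + 2Bθp + Cp²) with A = sin²(α)(χ⁻² − 1), B = cos(α)sin(α)(χ − χ⁻¹), C = sin²(α)(χ² − 1), α ∈ ℝ, χ > 0. Then E[min(1, exp(−ΔH))] = 1 − (2/π) arctan(√(E[ΔH]/2)). -/

import Mathlib

open MeasureTheory Real ProbabilityTheory

lemma integral_abs_mul_exp_neg_mul_sq {b : ℝ} (hb : 0 < b) :
    ∫ x : ℝ, |x| * exp (-b * x ^ 2) = b⁻¹ := by
  have h := integral_comp_abs (f := fun x : ℝ => x * exp (-b * x ^ 2))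
  simp only [sq_abs] at h
  rw [h]
  have h2 := integral_rpow_mul_exp_neg_mul_rpow (p := 2) (q := 1) (b := b)
    (by norm_num) (by norm_num) hb
  norm_num [Real.rpow_neg_one] at h2
  simp only [neg_mul]
  rw [h2]
  ring

lemma integrable_abs_mul_exp_neg_mul_sq {b : ℝ} (hb : 0 < b) :
    Integrable fun x : ℝ => |x| * exp (-b * x ^ 2) := by
  simpa [abs_mul, abs_of_pos (exp_pos _)] using (integrable_mul_exp_neg_mul_sq hb).abs

/-- Integrating out the scale `x` leaves an integral over the slope `t` only. -/
lemma integral_integral_abs_mul_exp_neg_mul_sq {m : ℝ → ℝ} (hm : Continuous m)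
    (hpos : ∀ t, 0 < m t) (hint : Integrable fun t => (m t)⁻¹) :
    ∫ x : ℝ, ∫ t : ℝ, |x| * exp (-m t * x ^ 2) = ∫ t : ℝ, (m t)⁻¹ := by
  rw [integral_integral_swap]
  · simp_rw [integral_abs_mul_exp_neg_mul_sq (hpos _)]
  · refine (integrable_prod_iff' ?_).2 ⟨?_, ?_⟩
    · exact Continuous.aestronglyMeasurable (by unfold Function.uncurry; fun_prop)
    · exact Filter.Eventually.of_forall fun t => integrable_abs_mul_exp_neg_mul_sq (hpos t)
    · simpa [Function.uncurry, abs_of_pos (exp_pos _), ← neg_mul,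
        integral_abs_mul_exp_neg_mul_sq (hpos _)] using hint

lemma integrable_inv_of_one_add_sq_le {m : ℝ → ℝ} (hm : Continuous m)
    (hle : ∀ t, 1 + t ^ 2 ≤ m t) : Integrable fun t => (m t)⁻¹ := by
  have hpos : ∀ t, 0 < m t := fun t => lt_of_lt_of_le (by positivity) (hle t)
  refine integrable_inv_one_add_sq.mono'
    (hm.inv₀ fun t => (hpos t).ne').aestronglyMeasurable (.of_forall fun t => ?_)
  rw [norm_of_nonneg (inv_nonneg.2 (hpos t).le)]
  exact inv_anti₀ (by positivity) (hle t)

lemma integral_inv_max_quadratic {k : ℝ} (hk : 1 ≤ k) :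
    ∫ t : ℝ, (max (1 + t ^ 2) (k ^ 2 + t ^ 2 / k ^ 2))⁻¹ =
      2 * (arctan k⁻¹ + (π / 2 - arctan k)) := by
  have hk0 : 0 < k := by linarith
  have hint := integrable_inv_of_one_add_sq_le
    (m := fun t => max (1 + t ^ 2) (k ^ 2 + t ^ 2 / k ^ 2)) (by fun_prop) fun t => le_max_left _ _
  have h := integral_comp_abs
    (f := fun t : ℝ => (max (1 + t ^ 2) (k ^ 2 + t ^ 2 / k ^ 2))⁻¹)
  simp only [sq_abs] at h
  have hdiff : ∀ t : ℝ, (k ^ 2 + t ^ 2 / k ^ 2) - (1 + t ^ 2)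
      = (k ^ 2 - 1) * (k ^ 2 - t ^ 2) / k ^ 2 := fun t => by field_simp; ring
  have hk1 : 0 ≤ k ^ 2 - 1 := by nlinarith
  rw [h, ← Set.Ioc_union_Ioi_eq_Ioi hk0.le, setIntegral_union (Set.Ioc_disjoint_Ioi le_rfl)
    measurableSet_Ioi hint.integrableOn hint.integrableOn]
  congr 2
  · have hcongr : ∫ t in Set.Ioc 0 k, (max (1 + t ^ 2) (k ^ 2 + t ^ 2 / k ^ 2))⁻¹
        = ∫ t in Set.Ioc 0 k, (k ^ 2 + t ^ 2 / k ^ 2)⁻¹ := by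
      refine setIntegral_congr_fun measurableSet_Ioc fun t ht => ?_
      have : 0 ≤ k ^ 2 - t ^ 2 := by nlinarith [ht.1, ht.2]
      have : 0 ≤ (k ^ 2 - 1) * (k ^ 2 - t ^ 2) / k ^ 2 := by positivity
      rw [max_eq_right (by linarith [hdiff t])]
    rw [hcongr, ← intervalIntegral.integral_of_le hk0.le,
      intervalIntegral.integral_eq_sub_of_hasDerivAt (f := fun t => arctan (t / k ^ 2))]
    · have : k / k ^ 2 = k⁻¹ := by field_simp
      simp [this]
    · intro t _
      convert! ((hasDerivAt_id t).div_const (k ^ 2)).arctan using 1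
      simp only [id]
      field_simp
    · refine (Continuous.inv₀ (by fun_prop) fun t => ?_).intervalIntegrable _ _
      positivity
  · rw [← integral_Ioi_inv_one_add_sq]
    refine setIntegral_congr_fun measurableSet_Ioi fun t ht => ?_
    have ht' : k < t := ht
    have : 0 ≤ t ^ 2 - k ^ 2 := by nlinarith
    have : 0 ≤ (k ^ 2 - 1) * (t ^ 2 - k ^ 2) / k ^ 2 := by positivity
    have h3 : (k ^ 2 - 1) * (k ^ 2 - t ^ 2) / k ^ 2 = -((k ^ 2 - 1) * (t ^ 2 - k ^ 2) / k ^ 2) := by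
      ring
    rw [max_eq_left (by linarith [hdiff t])]

lemma arctan_sub_arctan_inv {k : ℝ} (hk : 0 < k) :
    arctan k - arctan k⁻¹ = arctan ((k - k⁻¹) / 2) := by
  rw [sub_eq_add_neg, ← arctan_neg, arctan_add]
  · congr 1
    field_simp
    ring
  · have : k * -k⁻¹ = -1 := by field_simp
    linarith

/-- The acceptance probability for a diagonal energy error whose flow preserves area. -/
lemma integral_min_one_exp_neg_diagonal {k : ℝ} (hk : 1 ≤ k) :
    ∫ v : ℝ × ℝ, min 1 (exp (-((1 / 2) * ((k ^ 2 - 1) * v.1 ^ 2 + ((k ^ 2)⁻¹ - 1) * v.2 ^ 2))))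
      ∂((gaussianReal 0 1).prod (gaussianReal 0 1)) = 1 - 2 / π * arctan ((k - k⁻¹) / 2) := by
  have hk0 : 0 < k := by linarith
  set m : ℝ → ℝ := fun t => max (1 + t ^ 2) (k ^ 2 + t ^ 2 / k ^ 2) with hmdef
  have hmc : Continuous m := by fun_prop
  have hmpos : ∀ t, 0 < m t := fun t => lt_of_lt_of_le (by positivity) (le_max_left _ _)
  have hmint : Integrable fun t => (m t)⁻¹ :=
    integrable_inv_of_one_add_sq_le hmc fun t => le_max_left _ _
  have key : ∀ x : ℝ, x ≠ 0 →
      gaussianPDFReal 0 1 x * ∫ y, gaussianPDFReal 0 1 y *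
        min 1 (exp (-((1 / 2) * ((k ^ 2 - 1) * x ^ 2 + ((k ^ 2)⁻¹ - 1) * y ^ 2))))
      = (2 * π)⁻¹ * ∫ t, |x| * exp (-(m t / 2) * x ^ 2) := by
    intro x hx
    have hsub := Measure.integral_comp_mul_left (fun y => gaussianPDFReal 0 1 y *
        min 1 (exp (-((1 / 2) * ((k ^ 2 - 1) * x ^ 2 + ((k ^ 2)⁻¹ - 1) * y ^ 2))))) x
    have hsub' := congrArg (fun z => |x| * z) hsub
    simp only [smul_eq_mul, abs_inv, mul_inv_cancel_left₀ (abs_ne_zero.2 hx)] at hsub'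
    rw [← hsub', ← integral_const_mul, ← integral_const_mul, ← integral_const_mul]
    congr 1 with t
    have hexp : exp (-(m t / 2) * x ^ 2) = exp (-(1 + t ^ 2) / 2 * x ^ 2) *
        min 1 (exp (-((1 / 2) * ((k ^ 2 - 1) * x ^ 2 + ((k ^ 2)⁻¹ - 1) * (x * t) ^ 2)))) := by
      rw [mul_min_of_nonneg _ _ (exp_pos _).le, mul_one, ← exp_add, ← exp_monotone.map_min]
      congr 1
      have hx2 : 0 ≤ x ^ 2 / 2 := by positivity
      have : -(m t / 2) * x ^ 2 = -(x ^ 2 / 2 * m t) := by ring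
      rw [this, hmdef]
      simp only
      rw [mul_max_of_nonneg _ _ hx2, ← min_neg_neg]
      congr 1 <;> (field_simp; try ring)
    have hpdf : gaussianPDFReal 0 1 x * gaussianPDFReal 0 1 (x * t)
        = (2 * π)⁻¹ * exp (-(1 + t ^ 2) / 2 * x ^ 2) := by
      simp only [gaussianPDFReal, NNReal.coe_one, mul_one, sub_zero]
      rw [mul_mul_mul_comm, ← exp_add, ← mul_inv, mul_self_sqrt (by positivity)]
      congr 2
      ring
    rw [hexp]
    linear_combination (|x| * min 1 (exp (-((1 / 2) * ((k ^ 2 - 1) * x ^ 2 +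
      ((k ^ 2)⁻¹ - 1) * (x * t) ^ 2))))) * hpdf
  rw [integral_prod]
  · simp_rw [integral_gaussianReal_eq_integral_smul (one_ne_zero), smul_eq_mul]
    have hae : ∀ᵐ x : ℝ, x ≠ 0 := by simp [ae_iff]
    rw [integral_congr_ae (hae.mono key), integral_const_mul,
      integral_integral_abs_mul_exp_neg_mul_sq (by fun_prop) (fun t => by have := hmpos t; positivity)
        (by simpa [div_eq_mul_inv] using hmint.const_mul 2)]
    simp_rw [inv_div, div_eq_mul_inv]
    rw [integral_const_mul, integral_inv_max_quadratic hk]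
    have h1 := arctan_inv_of_pos hk0
    have h2 := arctan_sub_arctan_inv hk0
    rw [div_eq_mul_inv] at h2
    rw [← h2, h1]
    field_simp
    ring
  · refine Integrable.of_bound (C := 1) (Continuous.aestronglyMeasurable (by fun_prop))
      (.of_forall fun v => ?_)
    rw [norm_of_nonneg (le_min zero_le_one (exp_pos _).le)]
    exact min_le_left _ _

lemma integrable_sq_gaussianReal : Integrable (fun x : ℝ => x ^ 2) (gaussianReal 0 1) := by
  simpa using (memLp_id_gaussianReal (μ := 0) (v := 1) 2).integrable_sq

lemma integral_sq_gaussianReal : ∫ x : ℝ, x ^ 2 ∂(gaussianReal 0 1) = 1 := by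
  have h := variance_fun_id_gaussianReal (μ := 0) (v := 1)
  rw [variance_eq_integral measurable_id'.aemeasurable] at h
  simpa [integral_id_gaussianReal] using h

lemma integral_diagonal_quadratic_gaussianReal (a c : ℝ) :
    ∫ v : ℝ × ℝ, (1 / 2) * (a * v.1 ^ 2 + c * v.2 ^ 2)
      ∂((gaussianReal 0 1).prod (gaussianReal 0 1)) = (a + c) / 2 := by
  rw [integral_const_mul, integral_add
    ((integrable_sq_gaussianReal.comp_fst _).const_mul a)
    ((integrable_sq_gaussianReal.comp_snd _).const_mul c),
    integral_const_mul, integral_const_mul, integral_fun_fst (fun x : ℝ => x ^ 2),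
    integral_fun_snd (fun x : ℝ => x ^ 2), integral_sq_gaussianReal]
  simp
  ring

lemma integral_comp_rotation_gaussianReal (θ : ℝ) {f : ℝ × ℝ → ℝ} (hf : Continuous f) :
    ∫ v, f (cos θ * v.1 + sin θ * v.2, -sin θ * v.1 + cos θ * v.2)
        ∂((gaussianReal 0 1).prod (gaussianReal 0 1))
      = ∫ v, f v ∂((gaussianReal 0 1).prod (gaussianReal 0 1)) := by
  have h := IsGaussian.map_rotation_eq_self (μ := gaussianReal 0 1)
    (by simp [integral_id_gaussianReal]) θ
  conv_rhs => rw [← h]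
  rw [integral_map (by fun_prop) hf.aestronglyMeasurable]
  rfl

/-- A real quadratic form in two variables is diagonalised by a rotation. -/
lemma exists_rotation_diagonal (A B C : ℝ) :
    ∃ θ r : ℝ, 0 ≤ r ∧ r ^ 2 = (A - C) ^ 2 + 4 * B ^ 2 ∧ ∀ x y : ℝ,
      A * (cos θ * x + sin θ * y) ^ 2
        + 2 * B * (cos θ * x + sin θ * y) * (-sin θ * x + cos θ * y)
        + C * (-sin θ * x + cos θ * y) ^ 2
      = (A + C + r) / 2 * x ^ 2 + (A + C - r) / 2 * y ^ 2 := by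
  set z : ℂ := ⟨A - C, -(2 * B)⟩ with hz
  have h1 : ‖z‖ * cos (2 * (z.arg / 2)) = A - C := by
    rw [mul_div_cancel₀ _ two_ne_zero, Complex.norm_mul_cos_arg]
  have h2 : ‖z‖ * sin (2 * (z.arg / 2)) = -(2 * B) := by
    rw [mul_div_cancel₀ _ two_ne_zero, Complex.norm_mul_sin_arg]
  refine ⟨z.arg / 2, ‖z‖, norm_nonneg _, ?_, fun x y => ?_⟩
  · rw [Complex.sq_norm, Complex.normSq_mk]
    ring
  · set θ := z.arg / 2
    have h3 := sin_sq_add_cos_sq θ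
    rw [cos_two_mul'] at h1
    rw [sin_two_mul] at h2
    have hA : A = (A + C) / 2 + ‖z‖ * (cos θ ^ 2 - sin θ ^ 2) / 2 := by linarith
    have hC : C = (A + C) / 2 - ‖z‖ * (cos θ ^ 2 - sin θ ^ 2) / 2 := by linarith
    have hB : B = -(‖z‖ * (sin θ * cos θ)) := by linarith
    generalize hT : A + C = T at *
    rw [hA, hB, hC]
    have h4 : cos θ ^ 2 = 1 - sin θ ^ 2 := by linarith
    generalize cos θ = c at *
    generalize sin θ = s at *
    linear_combination (T / 2 * (x ^ 2 + y ^ 2)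
      + ‖z‖ / 2 * (c ^ 2 + s ^ 2 + 1) * (x ^ 2 - y ^ 2)) * h3

/-- Expected acceptance rate for HMC on the standard univariate Gaussian target:
`E[min(1, e^{-ΔH})] = 1 − (2/π) arctan √(E[ΔH]/2)`. -/
theorem expected_acceptance_univariate_gaussian
    (α χ : ℝ) (hχ : 0 < χ)
    (A B C : ℝ)
    (hA : A = Real.sin α ^ 2 * (χ⁻¹ ^ 2 - 1))
    (hB : B = Real.cos α * Real.sin α * (χ - χ⁻¹))
    (hC : C = Real.sin α ^ 2 * (χ ^ 2 - 1))
    (ΔH : ℝ × ℝ → ℝ)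
    (hΔH : ΔH = fun v =>
      (1 / 2) * (A * v.1 ^ 2 + 2 * B * v.1 * v.2 + C * v.2 ^ 2)) :
    (∫ v, min 1 (Real.exp (-ΔH v)) ∂((gaussianReal 0 1).prod (gaussianReal 0 1)))
      = 1 - (2 / Real.pi) * Real.arctan
          (Real.sqrt ((∫ v, ΔH v ∂((gaussianReal 0 1).prod (gaussianReal 0 1))) / 2)) := by
  obtain ⟨θ, r, hr, hr2, hrot⟩ := exists_rotation_diagonal A B C
  have htrace : A + C = (sin α * (χ - χ⁻¹)) ^ 2 := by
    rw [hA, hC]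
    field_simp
    ring
  have hdet : B ^ 2 - A * C = A + C := by
    have hcos := cos_sq' α
    rw [htrace, hA, hB, hC, mul_pow, mul_pow, hcos]
    field_simp
    ring
  have htrace_nonneg : 0 ≤ A + C := htrace ▸ sq_nonneg _
  set k := √(1 + (A + C + r) / 2) with hkdef
  have hk2 : k ^ 2 = 1 + (A + C + r) / 2 := sq_sqrt (by positivity)
  have hk : 1 ≤ k := one_le_sqrt.2 (by linarith)
  have hk0 : 0 < k := by linarith
  have hk2' : (k ^ 2)⁻¹ = 1 + (A + C - r) / 2 := by
    refine inv_eq_of_mul_eq_one_right ?_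
    rw [hk2]
    linear_combination -hr2 / 4 - hdet
  have hΔ : ∀ v : ℝ × ℝ, ΔH (cos θ * v.1 + sin θ * v.2, -sin θ * v.1 + cos θ * v.2)
      = (1 / 2) * ((k ^ 2 - 1) * v.1 ^ 2 + ((k ^ 2)⁻¹ - 1) * v.2 ^ 2) := fun v => by
    rw [hΔH, hk2', hk2]
    simp only
    rw [hrot]
    ring
  have hΔc : Continuous ΔH := by
    rw [hΔH]
    fun_prop
  rw [← integral_comp_rotation_gaussianReal θ hΔc,
    ← integral_comp_rotation_gaussianReal θ (f := fun v => min 1 (exp (-ΔH v))) (by fun_prop)]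
  simp_rw [hΔ]
  rw [integral_min_one_exp_neg_diagonal hk, integral_diagonal_quadratic_gaussianReal]
  congr 3
  have hsub : 0 ≤ k - k⁻¹ := sub_nonneg.2 ((inv_le_one_of_one_le₀ hk).trans hk)
  rw [eq_comm, sqrt_eq_iff_mul_self_eq (by
    have : (k ^ 2 - 1 + ((k ^ 2)⁻¹ - 1)) = (k - k⁻¹) ^ 2 := by field_simp; ring
    rw [this]; positivity) (by positivity)]
  field_simp
  ring
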